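/- Let n ≥ 17 be an integer and let f be a bounded continuous function on [0,∞). Then ‖D̃(Ṽ_n f)‖ ≤ (6 + 4√3)·n·‖f‖. -/

import Mathlib

open MeasureTheory Filter Set

/-- Baskakov basis functions `P_{n,k}(x)`, with `P_{n,k} := 0` for `k < 0`. -/
noncomputable def P (n : ℕ) (k : ℤ) (x : ℝ) : ℝ :=
  if k < 0 then 0
  else (Nat.choose (n + k.toNat - 1) k.toNat : ℝ) * x ^ k.toNat * (1 + x) ^ (-(n : ℤ) - k)

/-- The weight `ψ(x) = x(1+x)`. -/
noncomputable def psi (x : ℝ) : ℝ := x * (1 + x)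

/-- The differential operator `D̃ f = ψ f''`. -/
noncomputable def Dt (f : ℝ → ℝ) : ℝ → ℝ := fun x => psi x * deriv (deriv f) x

/-- The functionals `v_{n,k}`. -/
noncomputable def v (n k : ℕ) (f : ℝ → ℝ) : ℝ :=
  if k = 0 then f 0
  else ((n : ℝ) + 1) * ∫ t in Set.Ioi (0 : ℝ), P (n + 2) ((k : ℤ) - 1) t * f t

/-- The Goodman–Sharma–Baskakov operator `V_n`. -/
noncomputable def V (n : ℕ) (f : ℝ → ℝ) (x : ℝ) : ℝ :=
  ∑' k : ℕ, v n k f * P n (k : ℤ) x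

/-- The modified operator `Ṽ_n`. -/
noncomputable def Vt (n : ℕ) (f : ℝ → ℝ) (x : ℝ) : ℝ :=
  ∑' k : ℕ, v n k f * (P n (k : ℤ) x - (1 / (n : ℝ)) * Dt (P n (k : ℤ)) x)

/-- Supremum norm on `[0,∞)`. -/
noncomputable def supNorm (f : ℝ → ℝ) : ℝ := ⨆ x ∈ Set.Ici (0 : ℝ), |f x|

/-- `f` is bounded and continuous on `[0,∞)`. -/
def BddContOn (f : ℝ → ℝ) : Prop :=
  ContinuousOn f (Set.Ici 0) ∧ ∃ M, ∀ x ∈ Set.Ici (0 : ℝ), |f x| ≤ M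

/-- The space `W²(ψ)`: `g, g'` (locally) differentiable on `(0,∞)` and `D̃ g` bounded. -/
def MemW2 (g : ℝ → ℝ) : Prop :=
  DifferentiableOn ℝ g (Set.Ioi 0) ∧ DifferentiableOn ℝ (deriv g) (Set.Ioi 0) ∧
    ∃ M, ∀ x ∈ Set.Ioi (0 : ℝ), |Dt g x| ≤ M

/-- The space `W²₀(ψ)`: members of `W²(ψ)` with `D̃ g(x) → 0` as `x → 0⁺`. -/
def MemW20 (g : ℝ → ℝ) : Prop :=
  MemW2 g ∧ Filter.Tendsto (Dt g) (nhdsWithin 0 (Set.Ioi 0)) (nhds 0)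

/-- The K-functional `K(f,t)`. -/
noncomputable def Kfun (f : ℝ → ℝ) (t : ℝ) : ℝ :=
  sInf {a : ℝ | ∃ g : ℝ → ℝ, MemW20 g ∧ MemW2 (Dt g) ∧
    a = supNorm (fun x => f x - g x) + t * supNorm (Dt (Dt g))}

/-- The function `T_{n,k}(x)`. -/
noncomputable def T (n : ℕ) (k : ℤ) (x : ℝ) : ℝ :=
  (k : ℝ) * ((k : ℝ) - 1) * (1 + x) / x - 2 * (k : ℝ) * ((n : ℝ) + (k : ℝ))
    + ((n : ℝ) + (k : ℝ)) * ((n : ℝ) + (k : ℝ) + 1) * x / (1 + x)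

theorem P_of_neg {n : ℕ} {k : ℤ} (hk : k < 0) (x : ℝ) : P n k x = 0 := by
  simp [P, hk]

theorem P_succ_natCast (n k : ℕ) (x : ℝ) :
    P (n + 1) (k : ℤ) x = ((n + k).choose n : ℝ) * x ^ k * ((1 + x) ^ (n + 1 + k))⁻¹ := by
  have h : n + 1 + k - 1 = n + k := by omega
  have h2 : (-((n + 1 : ℕ) : ℤ) - (k : ℤ)) = -((n + 1 + k : ℕ) : ℤ) := by push_cast; ring
  have h3 : (n + k).choose k = (n + k).choose n := by
    rw [← Nat.choose_symm_add]
  unfold P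
  rw [if_neg (by omega), Int.toNat_natCast, h, h2, zpow_neg, zpow_natCast, h3]

theorem P_nonneg (n : ℕ) (k : ℤ) {x : ℝ} (hx : 0 ≤ x) : 0 ≤ P n k x := by
  unfold P
  split_ifs
  · exact le_rfl
  · positivity

theorem intCast_mul_P {n : ℕ} (hn : 1 ≤ n) (k : ℤ) (x : ℝ) :
    (k : ℝ) * P n k x = n * x * P (n + 1) (k - 1) x := by
  obtain ⟨m, rfl⟩ : ∃ m, n = m + 1 := ⟨n - 1, by omega⟩
  rcases lt_or_ge k 0 with hk | hk
  · rw [P_of_neg hk, P_of_neg (by omega)]; simp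
  lift k to ℕ using hk
  rcases k with _ | k
  · rw [P_of_neg (k := ((0 : ℕ) : ℤ) - 1) (by simp)]; simp
  · have h1 : (((k + 1 : ℕ) : ℤ) - 1) = (k : ℤ) := by push_cast; ring
    rw [h1, P_succ_natCast, P_succ_natCast]
    have hc : (k + 1 : ℝ) * ((m + (k + 1)).choose m : ℝ)
        = (m + 1) * ((m + 1 + k).choose (m + 1) : ℝ) := by
      have := Nat.choose_succ_right_eq (m + (k + 1)) m
      have h2 : m + (k + 1) - m = k + 1 := by omega
      have h3 : m + (k + 1) = m + 1 + k := by omega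
      rw [h2] at this
      rw [h3] at this ⊢
      have h4 := congrArg (Nat.cast (R := ℝ)) this
      push_cast at h4
      linarith
    have h5 : m + 1 + (k + 1) = m + 1 + 1 + k := by omega
    push_cast
    rw [h5, pow_succ x k]
    linear_combination (x ^ k * x * ((1 + x) ^ (m + 1 + 1 + k))⁻¹) * hc

theorem add_intCast_mul_P {n : ℕ} (hn : 1 ≤ n) (k : ℤ) {x : ℝ} (hx : 0 < x) :
    (n + k : ℝ) * P n k x = n * (1 + x) * P (n + 1) k x := by
  obtain ⟨m, rfl⟩ : ∃ m, n = m + 1 := ⟨n - 1, by omega⟩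
  rcases lt_or_ge k 0 with hk | hk
  · rw [P_of_neg hk, P_of_neg (by omega)]; simp
  lift k to ℕ using hk
  rw [P_succ_natCast, P_succ_natCast]
  have hc : (m + 1 + k : ℝ) * ((m + k).choose m : ℝ)
      = (m + 1) * ((m + 1 + k).choose (m + 1) : ℝ) := by
    have := Nat.add_one_mul_choose_eq (m + k) m
    have h3 : m + k + 1 = m + 1 + k := by omega
    rw [h3] at this
    have h4 := congrArg (Nat.cast (R := ℝ)) this
    push_cast at h4
    linarith
  have h5 : m + 1 + 1 + k = (m + 1 + k) + 1 := by omega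
  push_cast
  rw [h5, pow_succ (1 + x)]
  have : (1 + x) ≠ 0 := by positivity
  field_simp
  linear_combination hc

theorem hasDerivAt_P {n : ℕ} (hn : 1 ≤ n) (k : ℤ) {x : ℝ} (hx : 0 < x) :
    HasDerivAt (P n k) (n * (P (n + 1) (k - 1) x - P (n + 1) k x)) x := by
  have e1 := intCast_mul_P hn k x
  have e2 := add_intCast_mul_P hn k hx
  have hy : (1 + x) ≠ 0 := by positivity
  have e : (n * (P (n + 1) (k - 1) x - P (n + 1) k x) : ℝ)
      = P n k x * (k / x - (n + k) / (1 + x)) := by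
    field_simp
    linear_combination -(1 + x) * e1 + x * e2
  rw [e]
  obtain ⟨m, rfl⟩ : ∃ m, n = m + 1 := ⟨n - 1, by omega⟩
  rcases lt_or_ge k 0 with hk | hk
  · rw [P_of_neg hk, zero_mul]
    have : P (m + 1) k = fun _ => 0 := by
      ext y; exact P_of_neg hk y
    rw [this]; exact hasDerivAt_const x 0
  lift k to ℕ using hk
  have hf : P (m + 1) (k : ℤ) = fun y : ℝ =>
      ((m + k).choose m : ℝ) * y ^ k * ((1 + y) ^ (m + 1 + k))⁻¹ := by
    ext y; exact P_succ_natCast m k y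
  rw [hf]
  have d1 : HasDerivAt (fun y : ℝ => ((m + k).choose m : ℝ) * y ^ k)
      (((m + k).choose m : ℝ) * (k * x ^ (k - 1))) x :=
    (hasDerivAt_pow k x).const_mul _
  have d2 : HasDerivAt (fun y : ℝ => (1 + y) ^ (m + 1 + k))
      (((m + 1 + k : ℕ) : ℝ) * (1 + x) ^ (m + 1 + k - 1) * 1) x :=
    ((hasDerivAt_id x).const_add 1).pow (m + 1 + k)
  have d3 := d1.mul (d2.inv (pow_ne_zero _ hy))
  refine d3.congr_deriv ?_
  simp only [Pi.inv_apply]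
  have hN : m + 1 + k - 1 = m + k := by omega
  have hN' : m + 1 + k = m + k + 1 := by omega
  rw [hN, hN']
  rcases k with _ | k
  · push_cast
    field_simp
    ring
  · push_cast
    simp only [pow_succ]
    field_simp
    ring

theorem hasSum_P {n : ℕ} (hn : 1 ≤ n) {x : ℝ} (hx : 0 ≤ x) :
    HasSum (fun k : ℤ => P n k x) 1 := by
  obtain ⟨m, rfl⟩ : ∃ m, n = m + 1 := ⟨n - 1, by omega⟩
  rw [← Function.Injective.hasSum_iff (Nat.cast_injective (R := ℤ))]
  · have hy : (1 + x) ≠ 0 := by positivity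
    have hr : ‖x / (1 + x)‖ < 1 := by
      rw [Real.norm_of_nonneg (by positivity), div_lt_one (by positivity)]; linarith
    have h := (hasSum_choose_mul_geometric_of_norm_lt_one m hr).mul_right (((1 + x) ^ (m + 1))⁻¹)
    have e : 1 - x / (1 + x) = (1 + x)⁻¹ := by field_simp; ring
    rw [e] at h
    convert! h using 1
    · ext k
      simp only [Function.comp]
      rw [P_succ_natCast, add_comm m k, div_pow, pow_add]
      field_simp
    · rw [inv_pow, one_div, inv_inv, mul_inv_cancel₀ (pow_ne_zero _ hy)]
  · intro k hk
    refine P_of_neg ?_ x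
    by_contra h
    exact hk ⟨k.toNat, Int.toNat_of_nonneg (by omega)⟩

theorem P_le_mul_P {n : ℕ} (hn : 1 ≤ n) (k : ℤ) {x R : ℝ} (hx : 0 ≤ x) (hxR : x ≤ R) :
    P n k x ≤ (1 + R) ^ n * P n k R := by
  obtain ⟨m, rfl⟩ : ∃ m, n = m + 1 := ⟨n - 1, by omega⟩
  rcases lt_or_ge k 0 with hk | hk
  · rw [P_of_neg hk, P_of_neg hk]; simp
  lift k to ℕ using hk
  have hR : 0 ≤ R := hx.trans hxR
  rw [P_succ_natCast, P_succ_natCast]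
  have h1 : x / (1 + x) ≤ R / (1 + R) := by
    rw [div_le_div_iff₀ (by positivity) (by positivity)]; nlinarith
  have h2 : (x / (1 + x)) ^ k ≤ (R / (1 + R)) ^ k :=
    pow_le_pow_left₀ (by positivity) h1 k
  have h3 : ((1 + x) ^ (m + 1))⁻¹ ≤ 1 := inv_le_one_of_one_le₀ (one_le_pow₀ (by linarith))
  have hR' : (1 + R) ≠ 0 := by positivity
  calc ((m + k).choose m : ℝ) * x ^ k * ((1 + x) ^ (m + 1 + k))⁻¹
      = ((m + k).choose m : ℝ) * (x / (1 + x)) ^ k * ((1 + x) ^ (m + 1))⁻¹ := by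
        rw [div_pow, pow_add]; field_simp
    _ ≤ ((m + k).choose m : ℝ) * (R / (1 + R)) ^ k * 1 := by gcongr
    _ = _ := by rw [div_pow, pow_add]; field_simp; ring

/-- The `j`-th derivative of `P n k` on `(0,∞)`, as an iterated difference. -/
noncomputable def dP : ℕ → ℕ → ℤ → ℝ → ℝ
  | 0, n, k, x => P n k x
  | j + 1, n, k, x => n * (dP j (n + 1) (k - 1) x - dP j (n + 1) k x)

theorem dP_of_neg (j n : ℕ) {k : ℤ} (hk : k < 0) (x : ℝ) : dP j n k x = 0 := by
  induction j generalizing n k with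
  | zero => exact P_of_neg hk x
  | succ j ih => simp [dP, ih (n + 1) hk, ih (n + 1) (show k - 1 < 0 by omega)]

theorem hasDerivAt_dP (j : ℕ) {n : ℕ} (hn : 1 ≤ n) (k : ℤ) {x : ℝ} (hx : 0 < x) :
    HasDerivAt (dP j n k) (dP (j + 1) n k x) x := by
  induction j generalizing n k with
  | zero => exact hasDerivAt_P hn k hx
  | succ j ih =>
    exact ((ih (n := n + 1) (by omega) (k - 1)).sub (ih (n := n + 1) (by omega) k)).const_mul
      (n : ℝ)

theorem summable_comp_sub_one {a : ℤ → ℝ} (ha : Summable a) : Summable fun k => a (k - 1) :=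
  (Equiv.subRight (1 : ℤ)).summable_iff.2 ha

theorem hasSum_comp_sub_one {a : ℤ → ℝ} {s : ℝ} (ha : HasSum a s) :
    HasSum (fun k => a (k - 1)) s :=
  (Equiv.subRight (1 : ℤ)).hasSum_iff.2 ha

theorem exists_hasSum_abs_dP (j : ℕ) {n : ℕ} (hn : 1 ≤ n) {x : ℝ} (hx : 0 ≤ x) :
    ∃ s ≤ (2 : ℝ) ^ j * n.ascFactorial j, HasSum (fun k => |dP j n k x|) s := by
  induction j generalizing n with
  | zero =>
    refine ⟨1, by simp, ?_⟩
    have := hasSum_P hn hx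
    simpa [dP, abs_of_nonneg (P_nonneg n _ hx)] using this
  | succ j ih =>
    obtain ⟨s, hs, h⟩ := ih (n := n + 1) (by omega)
    have hb := ((hasSum_comp_sub_one h).add h).mul_left (n : ℝ)
    have hle : ∀ k, |dP (j + 1) n k x| ≤ n * (|dP j (n + 1) (k - 1) x| + |dP j (n + 1) k x|) := by
      intro k
      rw [dP, abs_mul, Nat.abs_cast]
      gcongr
      exact abs_sub _ _
    have hsum : Summable fun k => |dP (j + 1) n k x| :=
      Summable.of_nonneg_of_le (fun _ => abs_nonneg _) hle hb.summable
    refine ⟨_, ?_, hsum.hasSum⟩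
    refine (hasSum_le hle hsum.hasSum hb).trans ?_
    have hasc : (n.ascFactorial (j + 1) : ℝ) = n * (n + 1).ascFactorial j := by
      rw [Nat.ascFactorial_succ, ← Nat.succ_ascFactorial]; push_cast; ring
    rw [hasc, pow_succ]
    calc (n : ℝ) * (s + s) = 2 * n * s := by ring
      _ ≤ 2 * n * (2 ^ j * (n + 1).ascFactorial j) := by gcongr
      _ = _ := by ring

theorem summable_mul_dP {c : ℤ → ℝ} {M : ℝ} (hc : ∀ k, |c k| ≤ M) (j : ℕ) {n : ℕ} (hn : 1 ≤ n)
    {x : ℝ} (hx : 0 ≤ x) : Summable fun k => c k * dP j n k x := by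
  obtain ⟨s, -, h⟩ := exists_hasSum_abs_dP j hn hx
  refine Summable.of_norm_bounded (h.summable.mul_left M) fun k => ?_
  rw [Real.norm_eq_abs, abs_mul]
  exact mul_le_mul_of_nonneg_right (hc k) (abs_nonneg _)

theorem hasSum_mul_dP_succ {q : ℤ → ℝ} {j n : ℕ} {x A B : ℝ}
    (hA : HasSum (fun k => q k * dP j (n + 1) k x) A)
    (hB : HasSum (fun k => q (k + 1) * dP j (n + 1) k x) B) :
    HasSum (fun k => q k * dP (j + 1) n k x) (n * (B - A)) := by
  convert! ((hasSum_comp_sub_one hB).sub hA).mul_left (n : ℝ) using 1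
  ext k
  rw [dP, sub_add_cancel]
  ring

theorem tsum_mul_dP_succ {c : ℤ → ℝ} {M : ℝ} (hc : ∀ k, |c k| ≤ M) (j : ℕ) (n : ℕ)
    {x : ℝ} (hx : 0 ≤ x) : ∑' k, c k * dP (j + 1) n k x =
      n * ∑' k, (c (k + 1) - c k) * dP j (n + 1) k x := by
  have h1 := summable_mul_dP hc j (n := n + 1) (by omega) hx
  have h2 := summable_mul_dP (fun k => hc (k + 1)) j (n := n + 1) (by omega) hx
  rw [(hasSum_mul_dP_succ h1.hasSum h2.hasSum).tsum_eq, ← h2.tsum_sub h1]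
  simp only [sub_mul]

theorem hasDerivAt_tsum_mul_dP {c : ℤ → ℝ} {M : ℝ} (hc : ∀ k, |c k| ≤ M) (j : ℕ) {n : ℕ}
    (hn : 1 ≤ n) {x : ℝ} (hx : 0 < x) :
    HasDerivAt (fun y => ∑' k, c k * dP j n k y) (∑' k, c k * dP (j + 1) n k x) x := by
  have hM : 0 ≤ M := (abs_nonneg _).trans (hc 0)
  induction j generalizing n c M with
  | zero =>
    have hR : 0 ≤ x + 1 := by positivity
    have hP := (hasSum_P (n := n + 1) (by omega) hR).summable
    refine hasDerivAt_tsum_of_isPreconnected (t := Ioo 0 (x + 1)) (y₀ := x)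
      (g := fun k y => c k * dP 0 n k y) (g' := fun k y => c k * dP 1 n k y)
      (u := fun k => M * (n * ((1 + (x + 1)) ^ (n + 1) * P (n + 1) (k - 1) (x + 1)
        + (1 + (x + 1)) ^ (n + 1) * P (n + 1) k (x + 1))))
      ?_ isOpen_Ioo isPreconnected_Ioo ?_ ?_ ⟨hx, by linarith⟩ ?_ ⟨hx, by linarith⟩
    · exact ((((summable_comp_sub_one hP).mul_left _).add (hP.mul_left _)).mul_left _).mul_left _
    · intro k y hy
      exact (hasDerivAt_dP 0 hn k hy.1).const_mul _
    · intro k y hy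
      rw [Real.norm_eq_abs, abs_mul]
      refine mul_le_mul (hc k) ?_ (abs_nonneg _) hM
      simp only [dP]
      rw [abs_mul, Nat.abs_cast]
      gcongr
      refine (abs_sub _ _).trans (add_le_add ?_ ?_) <;>
      · rw [abs_of_nonneg (P_nonneg _ _ hy.1.le)]
        exact P_le_mul_P (by omega) _ hy.1.le hy.2.le
    · exact summable_mul_dP hc 0 hn hx.le
  | succ j ih =>
    have hc' : ∀ k, |c (k + 1) - c k| ≤ M + M := fun k =>
      (abs_sub _ _).trans (add_le_add (hc _) (hc _))
    rw [tsum_mul_dP_succ hc (j + 1) n hx.le]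
    refine ((ih hc' (n := n + 1) (by omega) (by linarith)).const_mul (n : ℝ)).congr_of_eventuallyEq
      ?_
    filter_upwards [Ioi_mem_nhds hx] with y hy
    exact tsum_mul_dP_succ hc j n (le_of_lt hy)

theorem dP_succ_eq_mul_P {j n : ℕ} (hn : 1 ≤ n) {x : ℝ} (hx : 0 < x) {q : ℤ → ℝ}
    (hq : ∀ m, dP j (n + 1) m x = q m * P (n + 1) m x) (k : ℤ) :
    dP (j + 1) n k x = (q (k - 1) * k / x - q k * (n + k) / (1 + x)) * P n k x := by
  have e1 := intCast_mul_P hn k x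
  have e2 := add_intCast_mul_P hn k hx
  have hy : (1 + x) ≠ 0 := by positivity
  rw [dP, hq, hq]
  field_simp
  linear_combination -(1 + x) * q (k - 1) * e1 + x * q k * e2

theorem dP_one_eq {n : ℕ} (hn : 1 ≤ n) (k : ℤ) {x : ℝ} (hx : 0 < x) :
    dP 1 n k x = (k / (x * (1 + x)) - n / (1 + x)) * P n k x := by
  rw [dP_succ_eq_mul_P (q := fun _ => 1) hn hx (fun m => by simp [dP])]
  have hy : (1 + x) ≠ 0 := by positivity
  congr 1
  field_simp
  ring

theorem dP_two_eq {n : ℕ} (hn : 1 ≤ n) (k : ℤ) {x : ℝ} (hx : 0 < x) :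
    dP 2 n k x = (k * (k - 1) / (x * (1 + x)) ^ 2 - 2 * (n + 1) * k / (x * (1 + x) * (1 + x))
      + n * (n + 1) / (1 + x) ^ 2) * P n k x := by
  rw [dP_succ_eq_mul_P hn hx (fun m => dP_one_eq (by omega) m hx)]
  have hy : (1 + x) ≠ 0 := by positivity
  congr 1
  push_cast
  field_simp
  ring

theorem dP_three_eq {n : ℕ} (hn : 1 ≤ n) (k : ℤ) {x : ℝ} (hx : 0 < x) :
    dP 3 n k x = (k * (k - 1) * (k - 2) / (x * (1 + x)) ^ 3
      - 3 * (n + 2) * (k * (k - 1)) / ((x * (1 + x)) ^ 2 * (1 + x))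
      + 3 * (n + 1) * (n + 2) * k / (x * (1 + x) * (1 + x) ^ 2)
      - n * (n + 1) * (n + 2) / (1 + x) ^ 3) * P n k x := by
  rw [dP_succ_eq_mul_P hn hx (fun m => dP_two_eq (by omega) m hx)]
  have hy : (1 + x) ≠ 0 := by positivity
  congr 1
  push_cast
  field_simp
  ring

theorem dP_four_eq {n : ℕ} (hn : 1 ≤ n) (k : ℤ) {x : ℝ} (hx : 0 < x) :
    dP 4 n k x = (k * (k - 1) * (k - 2) * (k - 3) / (x * (1 + x)) ^ 4
      - 4 * (n + 3) * (k * (k - 1) * (k - 2)) / ((x * (1 + x)) ^ 3 * (1 + x))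
      + 6 * (n + 2) * (n + 3) * (k * (k - 1)) / ((x * (1 + x)) ^ 2 * (1 + x) ^ 2)
      - 4 * (n + 1) * (n + 2) * (n + 3) * k / (x * (1 + x) * (1 + x) ^ 3)
      + n * (n + 1) * (n + 2) * (n + 3) / (1 + x) ^ 4) * P n k x := by
  rw [dP_succ_eq_mul_P hn hx (fun m => dP_three_eq (by omega) m hx)]
  have hy : (1 + x) ≠ 0 := by positivity
  congr 1
  push_cast
  field_simp
  ring

/-- The quartic polynomial with the given coefficients in the falling factorial basis. -/
noncomputable def quartic (a b c d e : ℝ) (k : ℤ) : ℝ :=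
  a + b * k + c * (k * (k - 1)) + d * (k * (k - 1) * (k - 2))
    + e * (k * (k - 1) * (k - 2) * (k - 3))

theorem quartic_add_one (a b c d e : ℝ) (k : ℤ) :
    quartic a b c d e (k + 1) = quartic (a + b) (b + 2 * c) (c + 3 * d) (d + 4 * e) e k := by
  simp only [quartic]
  push_cast
  ring

theorem hasSum_intCast_mul_P {n : ℕ} (hn : 1 ≤ n) {x s : ℝ} {a : ℤ → ℝ}
    (h : HasSum (fun k => a k * P (n + 1) k x) s) :
    HasSum (fun k : ℤ => k * a (k - 1) * P n k x) (n * x * s) := by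
  convert! (hasSum_comp_sub_one h).mul_left (n * x : ℝ) using 1
  ext k
  linear_combination a (k - 1) * intCast_mul_P hn k x

theorem hasSum_quartic_mul_P {n : ℕ} (hn : 1 ≤ n) {x : ℝ} (hx : 0 ≤ x) (a b c d e : ℝ) :
    HasSum (fun k => quartic a b c d e k * P n k x)
      (a + b * (n * x) + c * (n * (n + 1) * x ^ 2) + d * (n * (n + 1) * (n + 2) * x ^ 3)
        + e * (n * (n + 1) * (n + 2) * (n + 3) * x ^ 4)) := by
  have h0 : ∀ m : ℕ, 1 ≤ m → HasSum (fun k : ℤ => (1 : ℝ) * P m k x) 1 := fun m hm => by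
    simpa using hasSum_P hm hx
  have h1 := fun (m : ℕ) (hm : 1 ≤ m) => hasSum_intCast_mul_P hm (h0 (m + 1) (by omega))
  have h2 := fun (m : ℕ) (hm : 1 ≤ m) =>
    hasSum_intCast_mul_P (a := fun k => k * 1) hm (h1 (m + 1) (by omega))
  have h3 := fun (m : ℕ) (hm : 1 ≤ m) =>
    hasSum_intCast_mul_P (a := fun k => k * ((k - 1 : ℤ) * 1)) hm (h2 (m + 1) (by omega))
  have h4 := fun (m : ℕ) (hm : 1 ≤ m) =>
    hasSum_intCast_mul_P (a := fun k => k * ((k - 1 : ℤ) * ((k - 1 - 1 : ℤ) * 1))) hm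
      (h3 (m + 1) (by omega))
  convert! (((((h0 n hn).mul_left a).add ((h1 n hn).mul_left b)).add ((h2 n hn).mul_left c)).add
    ((h3 n hn).mul_left d)).add ((h4 n hn).mul_left e) using 1
  · ext k
    simp only [quartic]
    push_cast
    ring
  · push_cast
    ring

theorem hasSum_quartic_mul_dP_one {n : ℕ} (hn : 1 ≤ n) {x : ℝ} (hx : 0 ≤ x) (a b c d e : ℝ) :
    HasSum (fun k => quartic a b c d e k * dP 1 n k x)
      (b * n + 2 * c * (n * (n + 1) * x) + 3 * d * (n * (n + 1) * (n + 2) * x ^ 2)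
        + 4 * e * (n * (n + 1) * (n + 2) * (n + 3) * x ^ 3)) := by
  convert! hasSum_mul_dP_succ (j := 0) (n := n)
    (hasSum_quartic_mul_P (n := n + 1) (by omega) hx a b c d e)
    (by simp only [quartic_add_one]
        exact hasSum_quartic_mul_P (n := n + 1) (by omega) hx _ _ _ _ _) using 1
  push_cast
  ring

theorem hasSum_quartic_mul_dP_two {n : ℕ} (hn : 1 ≤ n) {x : ℝ} (hx : 0 ≤ x) (a b c d e : ℝ) :
    HasSum (fun k => quartic a b c d e k * dP 2 n k x)
      (2 * c * (n * (n + 1)) + 6 * d * (n * (n + 1) * (n + 2) * x)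
        + 12 * e * (n * (n + 1) * (n + 2) * (n + 3) * x ^ 2)) := by
  convert! hasSum_mul_dP_succ (j := 1) (n := n)
    (hasSum_quartic_mul_dP_one (n := n + 1) (by omega) hx a b c d e)
    (by simp only [quartic_add_one]
        exact hasSum_quartic_mul_dP_one (n := n + 1) (by omega) hx _ _ _ _ _) using 1
  push_cast
  ring

theorem hasSum_quartic_mul_dP_three {n : ℕ} (hn : 1 ≤ n) {x : ℝ} (hx : 0 ≤ x) (a b c d e : ℝ) :
    HasSum (fun k => quartic a b c d e k * dP 3 n k x)
      (6 * d * (n * (n + 1) * (n + 2)) + 24 * e * (n * (n + 1) * (n + 2) * (n + 3) * x)) := by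
  convert! hasSum_mul_dP_succ (j := 2) (n := n)
    (hasSum_quartic_mul_dP_two (n := n + 1) (by omega) hx a b c d e)
    (by simp only [quartic_add_one]
        exact hasSum_quartic_mul_dP_two (n := n + 1) (by omega) hx _ _ _ _ _) using 1
  push_cast
  ring

theorem hasSum_quartic_mul_dP_four {n : ℕ} (hn : 1 ≤ n) {x : ℝ} (hx : 0 ≤ x) (a b c d e : ℝ) :
    HasSum (fun k => quartic a b c d e k * dP 4 n k x)
      (24 * e * (n * (n + 1) * (n + 2) * (n + 3))) := by
  convert! hasSum_mul_dP_succ (j := 3) (n := n)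
    (hasSum_quartic_mul_dP_three (n := n + 1) (by omega) hx a b c d e)
    (by simp only [quartic_add_one]
        exact hasSum_quartic_mul_dP_three (n := n + 1) (by omega) hx _ _ _ _ _) using 1
  push_cast
  ring

/-- Squared weighted norm of a combination of the second, third and fourth derivatives. -/
theorem exists_hasSum_sq_mul_P {n : ℕ} (hn : 1 ≤ n) {x : ℝ} (hx : 0 < x) (α β γ : ℝ) :
    ∃ q : ℤ → ℝ, (∀ k, α * dP 2 n k x + β * dP 3 n k x + γ * dP 4 n k x = q k * P n k x) ∧
      HasSum (fun k => q k ^ 2 * P n k x)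
        (2 * α ^ 2 * (n * (n + 1)) / (x * (1 + x)) ^ 2
          + 6 * β ^ 2 * (n * (n + 1) * (n + 2)) / (x * (1 + x)) ^ 3
          + 24 * γ ^ 2 * (n * (n + 1) * (n + 2) * (n + 3)) / (x * (1 + x)) ^ 4) := by
  have hy : (1 + x) ≠ 0 := by positivity
  obtain ⟨a, ha⟩ : ∃ a : ℝ, a = α * (n * (n + 1) / (1 + x) ^ 2)
    - β * (n * (n + 1) * (n + 2) / (1 + x) ^ 3)
    + γ * (n * (n + 1) * (n + 2) * (n + 3) / (1 + x) ^ 4) := ⟨_, rfl⟩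
  obtain ⟨b, hb⟩ : ∃ b : ℝ, b = -α * (2 * (n + 1) / (x * (1 + x) * (1 + x)))
    + β * (3 * (n + 1) * (n + 2) / (x * (1 + x) * (1 + x) ^ 2))
    - γ * (4 * (n + 1) * (n + 2) * (n + 3) / (x * (1 + x) * (1 + x) ^ 3)) := ⟨_, rfl⟩
  obtain ⟨c, hc⟩ : ∃ c : ℝ, c = α / (x * (1 + x)) ^ 2
    - β * (3 * (n + 2) / ((x * (1 + x)) ^ 2 * (1 + x)))
    + γ * (6 * (n + 2) * (n + 3) / ((x * (1 + x)) ^ 2 * (1 + x) ^ 2)) := ⟨_, rfl⟩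
  obtain ⟨d, hd⟩ : ∃ d : ℝ, d = β / (x * (1 + x)) ^ 3
    - γ * (4 * (n + 3) / ((x * (1 + x)) ^ 3 * (1 + x))) := ⟨_, rfl⟩
  obtain ⟨e, he⟩ : ∃ e : ℝ, e = γ / (x * (1 + x)) ^ 4 := ⟨_, rfl⟩
  have key : ∀ k, α * dP 2 n k x + β * dP 3 n k x + γ * dP 4 n k x
      = quartic a b c d e k * P n k x := by
    intro k
    rw [dP_two_eq hn k hx, dP_three_eq hn k hx, dP_four_eq hn k hx, quartic, ha, hb, hc, hd, he]
    ring
  refine ⟨quartic a b c d e, key, ?_⟩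
  convert! (((hasSum_quartic_mul_dP_two hn hx.le a b c d e).mul_left α).add
    ((hasSum_quartic_mul_dP_three hn hx.le a b c d e).mul_left β)).add
    ((hasSum_quartic_mul_dP_four hn hx.le a b c d e).mul_left γ) using 1
  · ext k
    linear_combination -(quartic a b c d e k) * key k
  · rw [hc, hd, he]
    field_simp
    ring

theorem abs_le_supNorm {f : ℝ → ℝ} (hf : BddContOn f) {x : ℝ} (hx : 0 ≤ x) :
    |f x| ≤ supNorm f := by
  obtain ⟨-, M, hM⟩ := hf
  have hM0 : 0 ≤ M := (abs_nonneg _).trans (hM 0 (by simp))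
  refine le_ciSup_of_le ⟨M, ?_⟩ x ?_
  · rintro _ ⟨y, rfl⟩
    exact Real.iSup_le (fun hy => hM y hy) hM0
  · have hx' : x ∈ Ici (0 : ℝ) := hx
    simp [hx']

theorem supNorm_le {f : ℝ → ℝ} {C : ℝ} (hC : 0 ≤ C) (h : ∀ x, 0 ≤ x → |f x| ≤ C) :
    supNorm f ≤ C :=
  Real.iSup_le (fun x => Real.iSup_le (fun hx => h x hx) hC) hC

theorem continuousOn_P {n : ℕ} (hn : 1 ≤ n) (k : ℕ) : ContinuousOn (P n (k : ℤ)) (Ici 0) := by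
  obtain ⟨m, rfl⟩ : ∃ m, n = m + 1 := ⟨n - 1, by omega⟩
  have hf : P (m + 1) (k : ℤ) = fun y : ℝ =>
      ((m + k).choose m : ℝ) * y ^ k * ((1 + y) ^ (m + 1 + k))⁻¹ := by
    ext y; exact P_succ_natCast m k y
  rw [hf]
  refine ContinuousOn.mul (by fun_prop) (ContinuousOn.inv₀ (by fun_prop) ?_)
  intro y hy
  have : (0 : ℝ) ≤ y := hy
  positivity

theorem tendsto_P_atTop {n : ℕ} (hn : 1 ≤ n) (k : ℕ) :
    Tendsto (P n (k : ℤ)) atTop (nhds 0) := by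
  obtain ⟨m, rfl⟩ : ∃ m, n = m + 1 := ⟨n - 1, by omega⟩
  have h1 : Tendsto (fun y : ℝ => ((m + k).choose m : ℝ) * (1 + y)⁻¹) atTop (nhds 0) := by
    have := (tendsto_inv_atTop_zero.comp (tendsto_atTop_add_const_left atTop (1 : ℝ) tendsto_id))
    simpa using this.const_mul ((m + k).choose m : ℝ)
  refine squeeze_zero' ?_ ?_ h1
  · filter_upwards [eventually_ge_atTop 0] with y hy using P_nonneg _ _ hy
  · filter_upwards [eventually_ge_atTop 0] with y hy
    rw [P_succ_natCast, mul_assoc]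
    gcongr
    have hk : y ^ k ≤ (1 + y) ^ k := pow_le_pow_left₀ hy (by linarith) k
    have hm : 1 ≤ (1 + y) ^ m := one_le_pow₀ (by linarith)
    rw [← div_eq_mul_inv, div_le_iff₀ (by positivity),
      show (1 + y) ^ (m + 1 + k) = (1 + y) * ((1 + y) ^ m * (1 + y) ^ k) by ring,
      inv_mul_cancel_left₀ (by positivity)]
    nlinarith [pow_nonneg hy k]

theorem P_natCast_zero {n : ℕ} (hn : 1 ≤ n) (k : ℕ) : P n (k : ℤ) 0 = if k = 0 then 1 else 0 := by
  obtain ⟨m, rfl⟩ : ∃ m, n = m + 1 := ⟨n - 1, by omega⟩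
  rw [P_succ_natCast]
  split_ifs with h
  · simp [h]
  · simp [h]

theorem integrableOn_and_integral_P {n : ℕ} (hn : 1 ≤ n) (j : ℕ) :
    IntegrableOn (P (n + 1) (j : ℤ)) (Ioi 0) ∧ ∫ t in Ioi 0, P (n + 1) (j : ℤ) t = (n : ℝ)⁻¹ := by
  have hn0 : (n : ℝ) ≠ 0 := by positivity
  set g : ℝ → ℝ := fun x => ∑ i ∈ Finset.range (j + 1), P n (i : ℤ) x with hg
  have hderiv : ∀ x ∈ Ioi (0 : ℝ), HasDerivAt g (-(n * P (n + 1) (j : ℤ) x)) x := by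
    intro x hx
    have h := HasDerivAt.fun_sum (u := Finset.range (j + 1))
      fun i _ => hasDerivAt_P hn (i : ℤ) hx
    refine h.congr_deriv ?_
    rw [← Finset.mul_sum]
    have : ∀ J : ℕ, ∑ i ∈ Finset.range (J + 1),
        (P (n + 1) ((i : ℤ) - 1) x - P (n + 1) (i : ℤ) x) = -P (n + 1) (J : ℤ) x := by
      intro J
      induction J with
      | zero => simp [P_of_neg (n := n + 1) (k := -1) (by norm_num) x]
      | succ J ih =>
        rw [Finset.sum_range_succ, ih]
        push_cast
        rw [add_sub_cancel_right]
        ring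
    rw [this]
    ring
  have hneg : ∀ x ∈ Ioi (0 : ℝ), -(n * P (n + 1) (j : ℤ) x) ≤ 0 := fun x hx => by
    have := P_nonneg (n + 1) (j : ℤ) (le_of_lt hx)
    have h2 : 0 ≤ (n : ℝ) * P (n + 1) (j : ℤ) x := by positivity
    linarith
  have hcont : ContinuousWithinAt g (Ici 0) 0 :=
    (continuousOn_finsetSum _ fun i _ => continuousOn_P hn i) 0 self_mem_Ici
  have hlim : Tendsto g atTop (nhds 0) := by
    simpa using tendsto_finsetSum (Finset.range (j + 1)) fun i _ => tendsto_P_atTop hn i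
  have hg0 : g 0 = 1 := by
    simp [hg, P_natCast_zero hn]
  have hint := integrableOn_Ioi_deriv_of_nonpos hcont hderiv hneg hlim
  have hval := integral_Ioi_of_hasDerivAt_of_nonpos hcont hderiv hneg hlim
  constructor
  · have h := hint.const_mul (-(n : ℝ)⁻¹)
    refine h.congr (Eventually.of_forall fun x => ?_)
    field_simp
  · rw [hg0, integral_neg, integral_const_mul] at hval
    field_simp
    linarith

theorem abs_v_le {f : ℝ → ℝ} {M : ℝ} (hM : ∀ x, 0 ≤ x → |f x| ≤ M) (n k : ℕ) :
    |v n k f| ≤ M := by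
  unfold v
  split_ifs with hk
  · exact hM 0 le_rfl
  · obtain ⟨j, rfl⟩ : ∃ j, k = j + 1 := ⟨k - 1, by omega⟩
    obtain ⟨hint, hval⟩ := integrableOn_and_integral_P (n := n + 1) (by omega) j
    have hj : ((j + 1 : ℕ) : ℤ) - 1 = j := by push_cast; ring
    rw [hj, abs_mul, abs_of_nonneg (by positivity : (0 : ℝ) ≤ n + 1)]
    have h : ‖∫ t in Ioi (0 : ℝ), P (n + 2) (j : ℤ) t * f t‖
        ≤ ∫ t in Ioi (0 : ℝ), P (n + 2) (j : ℤ) t * M := by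
      refine norm_integral_le_of_norm_le (hint.mul_const M) ?_
      filter_upwards [ae_restrict_mem measurableSet_Ioi] with t ht
      have ht' : (0 : ℝ) ≤ t := le_of_lt ht
      rw [norm_mul, Real.norm_of_nonneg (P_nonneg _ _ ht')]
      exact mul_le_mul_of_nonneg_left (hM t ht') (P_nonneg _ _ ht')
    rw [integral_mul_const, hval, Real.norm_eq_abs] at h
    push_cast at h
    have hn : (0 : ℝ) < n + 1 := by positivity
    calc ((n : ℝ) + 1) * _ ≤ (n + 1) * ((n + 1 : ℝ)⁻¹ * M) := by gcongr
      _ = M := by field_simp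

theorem Dt_P {n : ℕ} (hn : 1 ≤ n) (k : ℤ) {x : ℝ} (hx : 0 < x) :
    Dt (P n k) x = psi x * dP 2 n k x := by
  have h : deriv (P n k) =ᶠ[nhds x] dP 1 n k := by
    filter_upwards [Ioi_mem_nhds hx] with y hy
    exact (hasDerivAt_dP 0 hn k hy).deriv
  rw [Dt, h.deriv_eq, (hasDerivAt_dP 1 hn k hx).deriv]

theorem Vt_eq {n : ℕ} (hn : 1 ≤ n) {f : ℝ → ℝ} {M : ℝ} (hM : ∀ x, 0 ≤ x → |f x| ≤ M)
    {x : ℝ} (hx : 0 < x) :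
    Vt n f x = ∑' k : ℤ, v n k.toNat f * dP 0 n k x
      - 1 / n * (psi x * ∑' k : ℤ, v n k.toNat f * dP 2 n k x) := by
  have hc : ∀ k : ℤ, |v n k.toNat f| ≤ M := fun k => abs_v_le hM n _
  have h0 := summable_mul_dP hc 0 hn hx.le
  have h2 := summable_mul_dP hc 2 hn hx.le
  rw [← tsum_mul_left, ← tsum_mul_left, ← h0.tsum_sub ((h2.mul_left _).mul_left _), Vt,
    ← Function.Injective.tsum_eq (Nat.cast_injective (R := ℤ))]
  · refine tsum_congr fun k => ?_
    rw [Dt_P hn _ hx, Int.toNat_natCast]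
    simp only [dP]
    ring
  · intro k hk
    by_contra h
    have hneg : k < 0 := by
      by_contra h'
      exact h ⟨k.toNat, Int.toNat_of_nonneg (by omega)⟩
    exact hk (by simp [dP_of_neg _ _ hneg])

theorem hasDerivAt_psi (x : ℝ) : HasDerivAt psi (1 + 2 * x) x := by
  have := (hasDerivAt_id x).mul ((hasDerivAt_id x).const_add 1)
  refine this.congr_deriv ?_
  simp
  ring

theorem Dt_Vt_eq {n : ℕ} (hn : 1 ≤ n) {f : ℝ → ℝ} {M : ℝ} (hM : ∀ x, 0 ≤ x → |f x| ≤ M)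
    {x : ℝ} (hx : 0 < x) :
    Dt (Vt n f) x = ∑' k : ℤ, v n k.toNat f * (psi x * (1 - 2 / n) * dP 2 n k x
      + -(2 / n * (1 + 2 * x) * psi x) * dP 3 n k x + -(psi x ^ 2 / n) * dP 4 n k x) := by
  have hc : ∀ k : ℤ, |v n k.toNat f| ≤ M := fun k => abs_v_le hM n _
  have hD := fun (j : ℕ) (y : ℝ) (hy : 0 < y) => hasDerivAt_tsum_mul_dP hc j hn hy
  obtain ⟨S, hS⟩ : ∃ S : ℕ → ℝ → ℝ,
      S = fun j y => ∑' k : ℤ, v n k.toNat f * dP j n k y := ⟨_, rfl⟩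
  have hS' : ∀ j y, 0 < y → HasDerivAt (S j) (S (j + 1) y) y := by
    intro j y hy; rw [hS]; exact hD j y hy
  have e0 : ∀ y, 0 < y → Vt n f y = S 0 y - 1 / n * (psi y * S 2 y) := by
    intro y hy; rw [hS]; exact Vt_eq hn hM hy
  have e1 : ∀ y, 0 < y → deriv (Vt n f) y
      = S 1 y - 1 / n * ((1 + 2 * y) * S 2 y + psi y * S 3 y) := by
    intro y hy
    have hev : Vt n f =ᶠ[nhds y] fun z => S 0 z - 1 / n * (psi z * S 2 z) := by
      filter_upwards [Ioi_mem_nhds hy] with z hz using e0 z hz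
    rw [hev.deriv_eq]
    exact ((hS' 0 y hy).sub (((hasDerivAt_psi y).mul (hS' 2 y hy)).const_mul _)).deriv
  have e2 : deriv (deriv (Vt n f)) x = S 2 x - 1 / n * ((2 * S 2 x + (1 + 2 * x) * S 3 x)
      + ((1 + 2 * x) * S 3 x + psi x * S 4 x)) := by
    have hev : deriv (Vt n f) =ᶠ[nhds x]
        fun z => S 1 z - 1 / n * ((1 + 2 * z) * S 2 z + psi z * S 3 z) := by
      filter_upwards [Ioi_mem_nhds hx] with z hz using e1 z hz
    rw [hev.deriv_eq]
    have hl : HasDerivAt (fun z : ℝ => 1 + 2 * z) 2 x := by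
      simpa using ((hasDerivAt_id x).const_mul 2).const_add 1
    exact ((hS' 1 x hx).sub (((hl.mul (hS' 2 x hx)).add
      ((hasDerivAt_psi x).mul (hS' 3 x hx))).const_mul _)).deriv
  have hs := fun j => (summable_mul_dP hc j hn hx.le).hasSum
  have hsum := (((hs 2).mul_left (psi x * (1 - 2 / n))).add
    ((hs 3).mul_left (-(2 / n * (1 + 2 * x) * psi x)))).add ((hs 4).mul_left (-(psi x ^ 2 / n)))
  rw [Dt, e2, tsum_congr (fun k => by ring : ∀ k : ℤ, _ = psi x * (1 - 2 / n) *
    (v n k.toNat f * dP 2 n k x) + -(2 / n * (1 + 2 * x) * psi x) * (v n k.toNat f * dP 3 n k x)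
    + -(psi x ^ 2 / n) * (v n k.toNat f * dP 4 n k x)), hsum.tsum_eq, hS]
  ring

/-- The kernel of `D̃ Ṽ_n` has an `ℓ¹` majorant of size `12.92 n`. -/
theorem exists_hasSum_kernel_bound {n : ℕ} (hn : 17 ≤ n) {x : ℝ} (hx : 0 < x) :
    ∃ (g : ℤ → ℝ) (s : ℝ), s ≤ 12.92 * n ∧ HasSum g s ∧ ∀ k,
      |psi x * (1 - 2 / n) * dP 2 n k x + -(2 / n * (1 + 2 * x) * psi x) * dP 3 n k x
        + -(psi x ^ 2 / n) * dP 4 n k x| ≤ g k := by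
  have hn1 : 1 ≤ n := by omega
  have hnR : (17 : ℝ) ≤ n := by exact_mod_cast hn
  have hn0 : (0 : ℝ) < n := by linarith
  have hψ : 0 < psi x := by unfold psi; positivity
  have hψx : psi x = x * (1 + x) := rfl
  have b1 : (n : ℝ) + 1 ≤ 1.06 * n := by linarith
  have b2 : (n : ℝ) + 2 ≤ 1.12 * n := by linarith
  have b3 : (n : ℝ) + 3 ≤ 1.18 * n := by linarith
  have c0 : 0 ≤ 1 - 2 / (n : ℝ) := by
    rw [sub_nonneg, div_le_one hn0]; linarith
  have c1 : 1 - 2 / (n : ℝ) ≤ 1 := by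
    have : 0 ≤ 2 / (n : ℝ) := by positivity
    linarith
  rcases le_total (n * psi x) 0.3 with hsmall | hlarge
  · obtain ⟨s2, hs2, h2⟩ := exists_hasSum_abs_dP 2 hn1 hx.le
    obtain ⟨s3, hs3, h3⟩ := exists_hasSum_abs_dP 3 hn1 hx.le
    obtain ⟨s4, hs4, h4⟩ := exists_hasSum_abs_dP 4 hn1 hx.le
    refine ⟨_, _, ?_, ((h2.mul_left (psi x * (1 - 2 / n))).add
      (h3.mul_left (2 / n * (1 + 2 * x) * psi x))).add (h4.mul_left (psi x ^ 2 / n)), ?_⟩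
    · have hψ' : psi x ≤ 0.3 / 17 := by nlinarith
      have hx2 : 1 + 2 * x ≤ 1.04 := by nlinarith
      have t2 : s2 ≤ 4 * (n * (1.06 * n)) := by
        refine hs2.trans ?_
        simp only [Nat.ascFactorial]
        push_cast
        nlinarith
      have t3 : s3 ≤ 8 * (n * (1.06 * n) * (1.12 * n)) := by
        refine hs3.trans ?_
        have : (n : ℝ) * (n + 1) * (n + 2) ≤ n * (1.06 * n) * (1.12 * n) := by gcongr
        simp only [Nat.ascFactorial]
        push_cast
        linarith
      have t4 : s4 ≤ 16 * (n * (1.06 * n) * (1.12 * n) * (1.18 * n)) := by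
        refine hs4.trans ?_
        have : (n : ℝ) * (n + 1) * (n + 2) * (n + 3)
          ≤ n * (1.06 * n) * (1.12 * n) * (1.18 * n) := by gcongr
        simp only [Nat.ascFactorial]
        push_cast
        linarith
      have p2 : 0 ≤ s2 := h2.nonneg fun _ => abs_nonneg _
      have p3 : 0 ≤ s3 := h3.nonneg fun _ => abs_nonneg _
      calc psi x * (1 - 2 / n) * s2 + 2 / n * (1 + 2 * x) * psi x * s3 + psi x ^ 2 / n * s4
          ≤ psi x * 1 * (4 * (n * (1.06 * n)))
            + 2 / n * 1.04 * psi x * (8 * (n * (1.06 * n) * (1.12 * n)))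
            + psi x ^ 2 / n * (16 * (n * (1.06 * n) * (1.12 * n) * (1.18 * n))) := by gcongr
        _ = (4.24 * (n * psi x) + 16.64 * 1.1872 * (n * psi x)
            + 16 * 1.400896 * (n * psi x) ^ 2) * n := by field_simp; ring
        _ ≤ (4.24 * 0.3 + 16.64 * 1.1872 * 0.3 + 16 * 1.400896 * 0.3 ^ 2) * n := by gcongr
        _ ≤ 12.92 * n := by gcongr; norm_num
    · intro k
      refine (abs_add_le _ _).trans (add_le_add ((abs_add_le _ _).trans (add_le_add ?_ ?_)) ?_)
      · rw [abs_mul, abs_of_nonneg (by positivity)]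
      · rw [abs_mul, abs_neg, abs_of_nonneg (by positivity)]
      · rw [abs_mul, abs_neg, abs_of_nonneg (by positivity)]
  · obtain ⟨q, hq, hsum⟩ := exists_hasSum_sq_mul_P hn1 hx (psi x * (1 - 2 / n))
      (-(2 / n * (1 + 2 * x) * psi x)) (-(psi x ^ 2 / n))
    have hC : (0 : ℝ) < 12.92 * n := by positivity
    refine ⟨_, _, ?_, ((hsum.mul_left (2 * (12.92 * (n : ℝ)))⁻¹).add
      ((hasSum_P hn1 hx.le).mul_left (12.92 * (n : ℝ) / 2))), ?_⟩
    · rw [← hψx]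
      have hx4 : (1 + 2 * x) ^ 2 = 1 + 4 * psi x := by rw [hψx]; ring
      have hinv : 1 / psi x ≤ n / 0.3 := by
        rw [div_le_div_iff₀ hψ (by norm_num)]; linarith
      have hS : 2 * (psi x * (1 - 2 / n)) ^ 2 * (n * (n + 1)) / psi x ^ 2
          + 6 * (-(2 / n * (1 + 2 * x) * psi x)) ^ 2 * (n * (n + 1) * (n + 2)) / psi x ^ 3
          + 24 * (-(psi x ^ 2 / n)) ^ 2 * (n * (n + 1) * (n + 2) * (n + 3)) / psi x ^ 4
          ≤ (12.92 * n) ^ 2 := by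
        calc _ = 2 * (1 - 2 / (n : ℝ)) ^ 2 * (n * (n + 1))
              + 24 * (1 + 2 * x) ^ 2 * (1 / psi x) * ((n + 1) * (n + 2)) / n
              + 24 * ((n + 1) * (n + 2) * (n + 3)) / n := by field_simp; ring
          _ = 2 * (1 - 2 / (n : ℝ)) ^ 2 * (n * (n + 1))
              + 24 * (1 / psi x + 4) * ((n + 1) * (n + 2)) / n
              + 24 * ((n + 1) * (n + 2) * (n + 3)) / n := by rw [hx4]; field_simp
          _ ≤ 2 * 1 ^ 2 * (n * (1.06 * n))
              + 24 * (n / 0.3 + 4 / 17 * n) * ((1.06 * n) * (1.12 * n)) / n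
              + 24 * ((1.06 * n) * (1.12 * n) * (1.18 * n)) / n := by
            gcongr
            linarith
          _ = (2.12 + 24 * (1 / 0.3 + 4 / 17) * 1.1872 + 24 * 1.400896) * (n : ℝ) ^ 2 := by
            field_simp
            ring
          _ ≤ 12.92 ^ 2 * (n : ℝ) ^ 2 := by gcongr; norm_num
          _ = _ := by ring
      calc _ ≤ (2 * (12.92 * (n : ℝ)))⁻¹ * (12.92 * n) ^ 2 + 12.92 * (n : ℝ) / 2 * 1 := by gcongr
        _ = _ := by field_simp; ring
    · intro k
      have hP := P_nonneg n k hx.le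
      rw [hq, abs_mul, abs_of_nonneg hP]
      have h : |q k| ≤ (2 * (12.92 * (n : ℝ)))⁻¹ * q k ^ 2 + 12.92 * (n : ℝ) / 2 := by
        have h1 : (2 * (12.92 * (n : ℝ)))⁻¹ * q k ^ 2 + 12.92 * (n : ℝ) / 2 - |q k|
            = (2 * (12.92 * (n : ℝ)))⁻¹ * (|q k| - 12.92 * n) ^ 2 := by
          rw [← sq_abs (q k)]
          field_simp
          ring
        have h2 : 0 ≤ (2 * (12.92 * (n : ℝ)))⁻¹ * (|q k| - 12.92 * n) ^ 2 := by positivity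
        linarith
      calc |q k| * P n k x
          ≤ ((2 * (12.92 * (n : ℝ)))⁻¹ * q k ^ 2 + 12.92 * (n : ℝ) / 2) * P n k x := by gcongr
        _ = _ := by ring

theorem bernstein_type_inequality (n : ℕ) (hn : 17 ≤ n) (f : ℝ → ℝ) (hf : BddContOn f) :
    supNorm (Dt (Vt n f)) ≤ (6 + 4 * Real.sqrt 3) * (n : ℝ) * supNorm f := by
  have hM : ∀ x, 0 ≤ x → |f x| ≤ supNorm f := fun x hx => abs_le_supNorm hf hx
  have hM0 : 0 ≤ supNorm f := (abs_nonneg _).trans (hM 0 le_rfl)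
  refine supNorm_le (by positivity) fun x hx => ?_
  rcases hx.eq_or_lt with rfl | hx
  · simp only [Dt, psi, zero_mul, abs_zero]
    positivity
  obtain ⟨g, s, hs, hg, hle⟩ := exists_hasSum_kernel_bound hn hx
  rw [Dt_Vt_eq (by omega) hM hx, ← Real.norm_eq_abs]
  refine (tsum_of_norm_bounded (hg.mul_left (supNorm f)) fun k => ?_).trans ?_
  · rw [Real.norm_eq_abs, abs_mul]
    exact mul_le_mul (abs_v_le hM n _) (hle k) (abs_nonneg _) hM0
  · have h3 : (1.73 : ℝ) ≤ Real.sqrt 3 := Real.le_sqrt_of_sq_le (by norm_num)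
    calc supNorm f * s ≤ supNorm f * (12.92 * n) := by gcongr
      _ ≤ supNorm f * ((6 + 4 * Real.sqrt 3) * n) := by gcongr; linarith
      _ = _ := by ring
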